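/- With the 2×2 matrix kernels K̃_{c,r}, K̃_{r,c}, K̃_{c,c} defined below, for all complex z and v with Im z ≥ 0 and Im v ≥ 0 one has ∫_{−∞}^{∞} K̃_{c,r}(z,y)·K̃_{r,c}(y,v) dy + 2·∫_{ℝ₊²} K̃_{c,c}(z,w)·K̃_{c,c}(w,v) d²w = 2·K̃_{c,c}(z,v), where ℝ₊² denotes the open upper half-plane {X + iY : X ∈ ℝ, Y > 0} and d²w = dX dY. -/

import Mathlib

open MeasureTheory Real Matrix

/-- The complementary error function `erfc s = (2/√π) ∫_s^∞ e^{-t²} dt`. -/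
noncomputable def erfc (s : ℝ) : ℝ := (2 / Real.sqrt π) * ∫ t in Set.Ioi s, Real.exp (-t ^ 2)

/-- The real-real block of the bulk-scaled real Ginibre correlation kernel. -/
noncomputable def Krr (x y : ℝ) : Matrix (Fin 2) (Fin 2) ℂ :=
  !![(((y - x) * Real.exp (-(x - y) ^ 2 / 2) / Real.sqrt (2 * π) : ℝ) : ℂ),
     ((Real.exp (-(x - y) ^ 2 / 2) / Real.sqrt (2 * π) : ℝ) : ℂ);
     ((-(Real.exp (-(x - y) ^ 2 / 2) / Real.sqrt (2 * π)) : ℝ) : ℂ),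
     (((1 / 2) * Real.sign (x - y) * erfc (|x - y| / Real.sqrt 2) : ℝ) : ℂ)]

/-- The real-complex block of the bulk-scaled real Ginibre correlation kernel. -/
noncomputable def Krc (x : ℝ) (w : ℂ) : Matrix (Fin 2) (Fin 2) ℂ :=
  ((1 / Real.sqrt (2 * π) * Real.sqrt (erfc (Real.sqrt 2 * w.im)) : ℝ) : ℂ) •
    !![(w - (x : ℂ)) * Complex.exp (-((x : ℂ) - w) ^ 2 / 2),
       Complex.I * ((starRingEnd ℂ) w - (x : ℂ)) *
         Complex.exp (-((x : ℂ) - (starRingEnd ℂ) w) ^ 2 / 2);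
       -Complex.exp (-((x : ℂ) - w) ^ 2 / 2),
       -Complex.I * Complex.exp (-((x : ℂ) - (starRingEnd ℂ) w) ^ 2 / 2)]

/-- The complex-complex block of the bulk-scaled real Ginibre correlation kernel. -/
noncomputable def Kcc (w z : ℂ) : Matrix (Fin 2) (Fin 2) ℂ :=
  ((1 / Real.sqrt (2 * π) *
      Real.sqrt (erfc (Real.sqrt 2 * w.im) * erfc (Real.sqrt 2 * z.im)) : ℝ) : ℂ) •
    !![(z - w) * Complex.exp (-(w - z) ^ 2 / 2),
       Complex.I * ((starRingEnd ℂ) z - w) * Complex.exp (-(w - (starRingEnd ℂ) z) ^ 2 / 2);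
       Complex.I * (z - (starRingEnd ℂ) w) * Complex.exp (-((starRingEnd ℂ) w - z) ^ 2 / 2),
       -((starRingEnd ℂ) z - (starRingEnd ℂ) w) *
         Complex.exp (-((starRingEnd ℂ) w - (starRingEnd ℂ) z) ^ 2 / 2)]

/-- The complex-real block of the bulk-scaled real Ginibre correlation kernel,
`K_{c,r}(z,x) = -(K_{r,c}(x,z))ᵀ`. -/
noncomputable def Kcr (z : ℂ) (x : ℝ) : Matrix (Fin 2) (Fin 2) ℂ := -(Krc x z)ᵀ

/-- `J = [[0,-1],[1,0]]`. -/
noncomputable def J2 : Matrix (Fin 2) (Fin 2) ℂ := !![0, -1; 1, 0]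

/-- Tilded kernel `K̃_{r,r}(x,y) = K_{r,r}(x,y) J`. -/
noncomputable def Ktrr (x y : ℝ) : Matrix (Fin 2) (Fin 2) ℂ := Krr x y * J2

/-- Tilded kernel `K̃_{r,c}(x,w) = K_{r,c}(x,w) J`. -/
noncomputable def Ktrc (x : ℝ) (w : ℂ) : Matrix (Fin 2) (Fin 2) ℂ := Krc x w * J2

/-- Tilded kernel `K̃_{c,r}(z,x) = K_{c,r}(z,x) J`. -/
noncomputable def Ktcr (z : ℂ) (x : ℝ) : Matrix (Fin 2) (Fin 2) ℂ := Kcr z x * J2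

/-- Tilded kernel `K̃_{c,c}(w,z) = K_{c,c}(w,z) J`. -/
noncomputable def Ktcc (w z : ℂ) : Matrix (Fin 2) (Fin 2) ℂ := Kcc w z * J2

attribute [local instance] Matrix.normedAddCommGroup Matrix.normedSpace

open Complex in
/-- A polynomial times a complex Gaussian is integrable on the line. -/
lemma integrable_pow_mul_cexp_neg_sq (c k : ℂ) (n : ℕ) :
    Integrable fun x : ℝ => (x : ℂ) ^ n * cexp (-(x : ℂ) ^ 2 + c * x + k) := by
  have hn : (-1 : ℝ) < (n : ℝ) := by linarith [n.cast_nonneg (α := ℝ)]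
  refine ((integrable_rpow_mul_exp_neg_mul_sq (b := 1 / 2) (by norm_num) hn).norm.const_mul
    (Real.exp (c.re ^ 2 / 2 + k.re))).mono' (by fun_prop) (.of_forall fun x => ?_)
  have h : Real.exp (-x ^ 2 + c.re * x + k.re) ≤
      Real.exp (c.re ^ 2 / 2 + k.re) * Real.exp (-(1 / 2) * x ^ 2) := by
    rw [← Real.exp_add]
    exact Real.exp_le_exp.2 (by nlinarith [sq_nonneg (x - c.re)])
  have hre : (-(x : ℂ) ^ 2 + c * x + k).re = -x ^ 2 + c.re * x + k.re := by
    simp [pow_two]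
  rw [norm_mul, norm_pow, Complex.norm_real, Complex.norm_exp, hre, norm_mul, Real.rpow_natCast,
    norm_pow, Real.norm_of_nonneg (Real.exp_pos (-(1 / 2) * x ^ 2)).le]
  calc _ ≤ ‖x‖ ^ n * (Real.exp (c.re ^ 2 / 2 + k.re) * Real.exp (-(1 / 2) * x ^ 2)) := by gcongr
    _ = _ := by ring

open Complex in
lemma integrable_affine_pow_mul_cexp_neg_sq (α β c k : ℂ) (n : ℕ) :
    Integrable fun x : ℝ => (α + β * x) ^ n * cexp (-(x : ℂ) ^ 2 + c * x + k) := by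
  have h : (fun x : ℝ => (α + β * x) ^ n * cexp (-(x : ℂ) ^ 2 + c * x + k)) = fun x : ℝ =>
      ∑ j ∈ Finset.range (n + 1), (α ^ j * β ^ (n - j) * n.choose j) *
        ((x : ℂ) ^ (n - j) * cexp (-(x : ℂ) ^ 2 + c * x + k)) := by
    ext x
    rw [add_pow, Finset.sum_mul]
    refine Finset.sum_congr rfl fun j _ => ?_
    rw [mul_pow]
    ring
  rw [h]
  exact integrable_finsetSum _ fun j _ => (integrable_pow_mul_cexp_neg_sq c k (n - j)).const_mul _

open Complex in
lemma integrable_sub_pow_mul_cexp_neg_sub_sq (m : ℂ) (n : ℕ) :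
    Integrable fun x : ℝ => ((x : ℂ) - m) ^ n * cexp (-((x : ℂ) - m) ^ 2) := by
  refine (integrable_affine_pow_mul_cexp_neg_sq (-m) 1 (2 * m) (-m ^ 2) n).congr
    (.of_forall fun x => ?_)
  dsimp only
  congr 2 <;> ring

open Complex in
lemma integral_cexp_neg_sub_sq (m : ℂ) :
    ∫ x : ℝ, cexp (-((x : ℂ) - m) ^ 2) = (√π : ℝ) := by
  have h := integral_cexp_quadratic (b := -1) (by simp) (2 * m) (-m ^ 2)
  have e : (π / - -1 : ℂ) ^ (1 / 2 : ℂ) = (√π : ℝ) := by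
    rw [Real.sqrt_eq_rpow, ofReal_cpow pi_pos.le]
    norm_num
  rw [e, show -m ^ 2 - (2 * m) ^ 2 / (4 * -1) = 0 by ring, Complex.exp_zero, mul_one] at h
  rw [← h]
  congr with x
  congr 1
  ring

open Complex in
lemma hasDerivAt_cexp_neg_affine_sq (α β : ℂ) (x : ℝ) :
    HasDerivAt (fun x : ℝ => cexp (-(α + β * x) ^ 2))
      (-2 * β * (α + β * x) * cexp (-(α + β * x) ^ 2)) x := by
  have h : HasDerivAt (fun x : ℝ => α + β * (x : ℂ)) β x := by
    simpa using ((ofRealCLM.hasDerivAt (x := x)).const_mul β).const_add α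
  refine (h.pow 2).neg.cexp.congr_deriv ?_
  simp only [Pi.neg_apply, Pi.pow_apply]
  push_cast
  ring

open Complex in
lemma hasDerivAt_affine_mul_cexp_neg_affine_sq (α β : ℂ) (x : ℝ) :
    HasDerivAt (fun x : ℝ => (α + β * x) * cexp (-(α + β * x) ^ 2))
      (-2 * β * (((α + β * x) ^ 2 - 1 / 2) * cexp (-(α + β * x) ^ 2))) x := by
  have h : HasDerivAt (fun x : ℝ => α + β * (x : ℂ)) β x := by
    simpa using ((ofRealCLM.hasDerivAt (x := x)).const_mul β).const_add α
  convert! h.mul (hasDerivAt_cexp_neg_affine_sq α β x) using 1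
  ring

open Complex in
lemma integral_sub_mul_cexp_neg_sub_sq (m : ℂ) :
    ∫ x : ℝ, ((x : ℂ) - m) * cexp (-((x : ℂ) - m) ^ 2) = 0 := by
  have h0 := integrable_sub_pow_mul_cexp_neg_sub_sq m 0
  have h1 := integrable_sub_pow_mul_cexp_neg_sub_sq m 1
  simp only [pow_zero, one_mul, pow_one] at h0 h1
  have h := integral_eq_zero_of_hasDerivAt_of_integrable
    (f := fun x : ℝ => cexp (-((x : ℂ) - m) ^ 2))
    (f' := fun x : ℝ => -2 * (((x : ℂ) - m) * cexp (-((x : ℂ) - m) ^ 2)))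
    (fun x => by
      convert! hasDerivAt_cexp_neg_affine_sq (-m) 1 x using 1
      · ext y; congr 3; ring
      · rw [show -m + 1 * (x : ℂ) = x - m by ring]; ring)
    (h1.const_mul _) h0
  rw [integral_const_mul] at h
  simpa using h

open Complex in
lemma integral_sub_sq_mul_cexp_neg_sub_sq (m : ℂ) :
    ∫ x : ℝ, ((x : ℂ) - m) ^ 2 * cexp (-((x : ℂ) - m) ^ 2) = (√π : ℝ) / 2 := by
  have h0 := integrable_sub_pow_mul_cexp_neg_sub_sq m 0
  have h1 := integrable_sub_pow_mul_cexp_neg_sub_sq m 1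
  have h2 := integrable_sub_pow_mul_cexp_neg_sub_sq m 2
  simp only [pow_zero, one_mul, pow_one] at h0 h1
  have h := integral_eq_zero_of_hasDerivAt_of_integrable
    (f := fun x : ℝ => ((x : ℂ) - m) * cexp (-((x : ℂ) - m) ^ 2))
    (f' := fun x : ℝ => -2 * (((x : ℂ) - m) ^ 2 * cexp (-((x : ℂ) - m) ^ 2)) +
      cexp (-((x : ℂ) - m) ^ 2))
    (fun x => by
      convert! hasDerivAt_affine_mul_cexp_neg_affine_sq (-m) 1 x using 1
      · ext y; rw [show -m + 1 * (y : ℂ) = y - m by ring]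
      · rw [show -m + 1 * (x : ℂ) = x - m by ring]; ring)
    ((h2.const_mul _).add h0) h1
  rw [integral_add (h2.const_mul _) h0, integral_const_mul, integral_cexp_neg_sub_sq] at h
  linear_combination (-1 / 2) * h

lemma integrable_exp_neg_sq : Integrable fun t : ℝ => Real.exp (-t ^ 2) := by
  simpa using integrable_exp_neg_mul_sq (b := 1) one_pos

lemma erfc_nonneg (s : ℝ) : 0 ≤ erfc s :=
  mul_nonneg (by positivity) (integral_nonneg fun _ => (Real.exp_pos _).le)

lemma erfc_zero : erfc 0 = 1 := by
  have h := integral_gaussian_Ioi 1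
  simp only [neg_mul, one_mul, div_one] at h
  rw [erfc, h]
  have : √π ≠ 0 := by positivity
  field_simp

lemma erfc_le {s : ℝ} (hs : 0 ≤ s) : erfc s ≤ 2 * Real.exp (-s ^ 2) := by
  have hg : Integrable fun t : ℝ => Real.exp (-(t - s) ^ 2) := integrable_exp_neg_sq.comp_sub_right s
  have hgauss : ∫ t : ℝ, Real.exp (-(t - s) ^ 2) = √π := by
    rw [integral_sub_right_eq_self (fun t : ℝ => Real.exp (-t ^ 2))]
    simpa using integral_gaussian 1
  have h : ∫ t in Set.Ioi s, Real.exp (-t ^ 2) ≤ Real.exp (-s ^ 2) * √π := by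
    calc ∫ t in Set.Ioi s, Real.exp (-t ^ 2)
        ≤ ∫ t in Set.Ioi s, Real.exp (-s ^ 2) * Real.exp (-(t - s) ^ 2) := by
          refine setIntegral_mono_on integrable_exp_neg_sq.integrableOn
            (hg.const_mul _).integrableOn measurableSet_Ioi fun t ht => ?_
          rw [← Real.exp_add]
          gcongr
          nlinarith [mul_nonneg hs (sub_nonneg.2 (Set.mem_Ioi.1 ht).le)]
      _ ≤ ∫ t, Real.exp (-s ^ 2) * Real.exp (-(t - s) ^ 2) :=
          setIntegral_le_integral (hg.const_mul _) (.of_forall fun t => by positivity)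
      _ = _ := by rw [integral_const_mul, hgauss]
  rw [erfc]
  calc _ ≤ 2 / √π * (Real.exp (-s ^ 2) * √π) := by gcongr
    _ = _ := by field_simp

lemma hasDerivAt_erfc (s : ℝ) : HasDerivAt erfc (-(2 / √π) * Real.exp (-s ^ 2)) s := by
  have hc : Continuous fun t : ℝ => Real.exp (-t ^ 2) := by fun_prop
  have h : erfc = fun s => 2 / √π *
      ((∫ t in Set.Ioi 0, Real.exp (-t ^ 2)) - ∫ t in (0 : ℝ)..s, Real.exp (-t ^ 2)) := by
    ext s
    rw [erfc, ← intervalIntegral.integral_Ioi_sub_Ioi' integrable_exp_neg_sq.integrableOn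
      integrable_exp_neg_sq.integrableOn, sub_sub_cancel]
  rw [h]
  convert! ((hc.integral_hasStrictDerivAt 0 s).hasDerivAt.const_sub _).const_mul (2 / √π) using 1
  ring

lemma hasDerivAt_erfc_sqrt_two_mul (y : ℝ) :
    HasDerivAt (fun y => erfc (√2 * y)) (-(2 * √2 / √π) * Real.exp (-(2 * y ^ 2))) y := by
  convert! (hasDerivAt_erfc (√2 * y)).comp y ((hasDerivAt_id y).const_mul (√2)) using 1
  rw [mul_pow, Real.sq_sqrt zero_le_two]
  ring

open Complex in
lemma integrable_affine_pow_mul_cexp_mul_gaussian (δ : ℂ) {β : ℂ} (hβ : β ^ 2 = -1) (n : ℕ) :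
    Integrable fun y : ℝ => (δ + β * y) ^ n * cexp (-(δ + β * y) ^ 2) *
      (Real.exp (-(2 * y ^ 2)) : ℝ) := by
  refine (integrable_affine_pow_mul_cexp_neg_sq δ β (-2 * δ * β) (-δ ^ 2) n).congr
    (.of_forall fun x => ?_)
  dsimp only
  rw [mul_assoc _ (cexp _) _, ofReal_exp, ← Complex.exp_add]
  congr 2
  push_cast
  linear_combination (x : ℂ) ^ 2 * hβ

open Complex in
lemma integrableOn_erfc_mul_affine_pow_mul_cexp (δ : ℂ) {β : ℂ} (hβ : β ^ 2 = -1) (n : ℕ) :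
    IntegrableOn (fun y : ℝ => (erfc (√2 * y) : ℂ) *
      ((δ + β * y) ^ n * cexp (-(δ + β * y) ^ 2))) (Set.Ioi 0) := by
  have hc : Continuous fun y => erfc (√2 * y) :=
    continuous_iff_continuousAt.2 fun y => (hasDerivAt_erfc_sqrt_two_mul y).continuousAt
  refine ((integrable_affine_pow_mul_cexp_mul_gaussian δ hβ n).norm.const_mul 2).integrableOn.mono'
    (by fun_prop) ((ae_restrict_iff' measurableSet_Ioi).2 (.of_forall fun y hy => ?_))
  have h := erfc_le (mul_nonneg (Real.sqrt_nonneg 2) (Set.mem_Ioi.1 hy).le)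
  rw [mul_pow, Real.sq_sqrt zero_le_two] at h
  rw [norm_mul, norm_mul (_ * _), Complex.norm_real, Complex.norm_real,
    Real.norm_of_nonneg (erfc_nonneg _), Real.norm_of_nonneg (Real.exp_pos _).le]
  calc _ ≤ (2 * Real.exp (-(2 * y ^ 2))) * ‖(δ + β * y) ^ n * cexp (-(δ + β * y) ^ 2)‖ := by gcongr
    _ = _ := by ring

open Complex in
lemma integral_erfc_mul_gaussian_by_parts (δ : ℂ) {β : ℂ} (hβ : β ^ 2 = -1) :
    -2 * β * ∫ y in Set.Ioi (0 : ℝ), (erfc (√2 * y) : ℂ) *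
        (((δ + β * y) ^ 2 - 1 / 2) * cexp (-(δ + β * y) ^ 2)) =
      -(δ * cexp (-δ ^ 2)) + (2 * √2 / √π : ℝ) * ∫ y in Set.Ioi (0 : ℝ),
        (δ + β * y) * cexp (-(δ + β * y) ^ 2) * (Real.exp (-(2 * y ^ 2)) : ℝ) := by
  have i0 := integrableOn_erfc_mul_affine_pow_mul_cexp δ hβ 0
  have i1 := integrableOn_erfc_mul_affine_pow_mul_cexp δ hβ 1
  have i2 := integrableOn_erfc_mul_affine_pow_mul_cexp δ hβ 2
  have j1 := (integrable_affine_pow_mul_cexp_mul_gaussian δ hβ 1).integrableOn (s := Set.Ioi 0)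
  simp only [pow_zero, one_mul, pow_one] at i0 i1 j1
  have i : IntegrableOn (fun y : ℝ => (erfc (√2 * y) : ℂ) *
      (((δ + β * y) ^ 2 - 1 / 2) * cexp (-(δ + β * y) ^ 2))) (Set.Ioi 0) := by
    refine (i2.sub (i0.const_mul (1 / 2))).congr (.of_forall fun y => ?_)
    simp only [Pi.sub_apply]
    ring
  have hd (y : ℝ) : HasDerivAt
      (fun y : ℝ => (erfc (√2 * y) : ℂ) * ((δ + β * y) * cexp (-(δ + β * y) ^ 2)))
      (-2 * β * ((erfc (√2 * y) : ℂ) * (((δ + β * y) ^ 2 - 1 / 2) * cexp (-(δ + β * y) ^ 2))) -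
        (2 * √2 / √π : ℝ) *
          ((δ + β * y) * cexp (-(δ + β * y) ^ 2) * (Real.exp (-(2 * y ^ 2)) : ℝ))) y := by
    convert! (hasDerivAt_erfc_sqrt_two_mul y).ofReal_comp.mul
      (hasDerivAt_affine_mul_cexp_neg_affine_sq δ β y) using 1
    push_cast
    ring
  have hi := (i.const_mul (-2 * β)).sub (j1.const_mul ((2 * √2 / √π : ℝ) : ℂ))
  have h := integral_Ioi_of_hasDerivAt_of_tendsto' (fun y _ => hd y) hi
    (tendsto_zero_of_hasDerivAt_of_integrableOn_Ioi (fun y _ => hd y) hi i1)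
  rw [integral_sub (i.const_mul _) (j1.const_mul _), integral_const_mul, integral_const_mul] at h
  simp only [ofReal_zero, mul_zero, add_zero, erfc_zero, ofReal_one, one_mul, zero_sub] at h
  linear_combination h

open Complex in
lemma integral_Ioi_gaussian_symmetrized (δ : ℂ) :
    (∫ y in Set.Ioi (0 : ℝ), (δ + -I * y) * cexp (-(δ + -I * y) ^ 2) *
        (Real.exp (-(2 * y ^ 2)) : ℝ)) +
      (∫ y in Set.Ioi (0 : ℝ), (δ + I * y) * cexp (-(δ + I * y) ^ 2) *
        (Real.exp (-(2 * y ^ 2)) : ℝ)) = 2 * δ * cexp (-(2 * δ ^ 2)) * (√π : ℝ) := by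
  have hi := integrable_affine_pow_mul_cexp_mul_gaussian δ I_sq 1
  simp only [pow_one] at hi
  have hneg := integral_comp_neg_Ioi 0 fun y : ℝ =>
    (δ + I * y) * cexp (-(δ + I * y) ^ 2) * ((Real.exp (-(2 * y ^ 2)) : ℝ) : ℂ)
  simp only [ofReal_neg, mul_neg, neg_sq, neg_zero] at hneg
  simp only [neg_mul]
  rw [hneg, intervalIntegral.integral_Iic_add_Ioi hi.integrableOn hi.integrableOn]
  have h0 := integrable_sub_pow_mul_cexp_neg_sub_sq (-(I * δ)) 0
  have h1 := integrable_sub_pow_mul_cexp_neg_sub_sq (-(I * δ)) 1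
  simp only [pow_zero, one_mul, pow_one] at h0 h1
  have e (y : ℝ) : (δ + I * y) * cexp (-(δ + I * y) ^ 2) * ((Real.exp (-(2 * y ^ 2)) : ℝ) : ℂ) =
      (I * cexp (-(2 * δ ^ 2))) * (((y : ℂ) - -(I * δ)) * cexp (-((y : ℂ) - -(I * δ)) ^ 2)) +
      (2 * δ * cexp (-(2 * δ ^ 2))) * cexp (-((y : ℂ) - -(I * δ)) ^ 2) := by
    have : cexp (-(δ + I * y) ^ 2) * ((Real.exp (-(2 * y ^ 2)) : ℝ) : ℂ) =
        cexp (-(2 * δ ^ 2)) * cexp (-((y : ℂ) - -(I * δ)) ^ 2) := by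
      rw [ofReal_exp, ← Complex.exp_add, ← Complex.exp_add]
      congr 1
      push_cast
      linear_combination (δ ^ 2 - (y : ℂ) ^ 2) * I_sq
    rw [mul_assoc, this]
    linear_combination (-δ * cexp (-(2 * δ ^ 2)) * cexp (-((y : ℂ) - -(I * δ)) ^ 2)) * I_sq
  simp only [e]
  rw [integral_add (h1.const_mul _) (h0.const_mul _), integral_const_mul, integral_const_mul,
    integral_cexp_neg_sub_sq, integral_sub_mul_cexp_neg_sub_sq]
  ring

open Complex in
/-- The odd Gaussian `a e^{-a²/2}` out of which the Ginibre kernels are built. -/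
noncomputable def oddGaussian (a : ℂ) : ℂ := a * cexp (-a ^ 2 / 2)

lemma restrict_upper_half_plane :
    (volume : Measure (ℝ × ℝ)).restrict {q | 0 < q.2} =
      (volume : Measure ℝ).prod ((volume : Measure ℝ).restrict (Set.Ioi 0)) := by
  have : {q : ℝ × ℝ | 0 < q.2} = Set.univ ×ˢ Set.Ioi 0 := by ext; simp
  rw [this, Measure.volume_eq_prod, ← Measure.prod_restrict, Measure.restrict_univ]

open Complex in
lemma oddGaussian_mul_oddGaussian (a b β x y : ℂ) :
    oddGaussian (x + β * y - a) * oddGaussian (b - x + β * y) =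
      cexp (-(x - (a + b) / 2) ^ 2) *
        (((b - a) / 2 + β * y) ^ 2 * cexp (-((b - a) / 2 + β * y) ^ 2)) -
      (x - (a + b) / 2) ^ 2 * cexp (-(x - (a + b) / 2) ^ 2) *
        cexp (-((b - a) / 2 + β * y) ^ 2) := by
  have h : cexp (-(x + β * y - a) ^ 2 / 2) * cexp (-(b - x + β * y) ^ 2 / 2) =
      cexp (-(x - (a + b) / 2) ^ 2) * cexp (-((b - a) / 2 + β * y) ^ 2) := by
    rw [← Complex.exp_add, ← Complex.exp_add]
    congr 1
    ring
  rw [oddGaussian, oddGaussian]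
  linear_combination (x + β * y - a) * (b - x + β * y) * h

open Complex in
lemma integrable_and_integral_erfc_mul_oddGaussian (a b : ℂ) {β : ℂ} (hβ : β ^ 2 = -1) :
    IntegrableOn (fun p : ℝ × ℝ => (erfc (√2 * p.2) : ℂ) *
      (oddGaussian (p.1 + β * p.2 - a) * oddGaussian (b - p.1 + β * p.2))) {q | 0 < q.2} ∧
    ∫ p in {q : ℝ × ℝ | 0 < q.2}, (erfc (√2 * p.2) : ℂ) *
      (oddGaussian (p.1 + β * p.2 - a) * oddGaussian (b - p.1 + β * p.2)) =
    (√π : ℝ) * ∫ y in Set.Ioi (0 : ℝ), (erfc (√2 * y) : ℂ) *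
        ((((b - a) / 2 + β * y) ^ 2 - 1 / 2) * cexp (-((b - a) / 2 + β * y) ^ 2)) := by
  have e (p : ℝ × ℝ) : (erfc (√2 * p.2) : ℂ) *
      (oddGaussian (p.1 + β * p.2 - a) * oddGaussian (b - p.1 + β * p.2)) =
      cexp (-(p.1 - (a + b) / 2) ^ 2) * ((erfc (√2 * p.2) : ℂ) *
        (((b - a) / 2 + β * p.2) ^ 2 * cexp (-((b - a) / 2 + β * p.2) ^ 2))) -
      (p.1 - (a + b) / 2) ^ 2 * cexp (-(p.1 - (a + b) / 2) ^ 2) *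
        ((erfc (√2 * p.2) : ℂ) * cexp (-((b - a) / 2 + β * p.2) ^ 2)) := by
    rw [oddGaussian_mul_oddGaussian]
    ring
  have i0 := integrableOn_erfc_mul_affine_pow_mul_cexp ((b - a) / 2) hβ 0
  have i2 := integrableOn_erfc_mul_affine_pow_mul_cexp ((b - a) / 2) hβ 2
  have h0 := integrable_sub_pow_mul_cexp_neg_sub_sq ((a + b) / 2) 0
  have h2 := integrable_sub_pow_mul_cexp_neg_sub_sq ((a + b) / 2) 2
  simp only [pow_zero, one_mul] at i0 h0
  have k2 := h0.mul_prod i2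
  have k0 := h2.mul_prod i0
  simp only [e]
  rw [IntegrableOn, restrict_upper_half_plane]
  refine ⟨k2.sub k0, ?_⟩
  rw [integral_sub k2 k0,
    integral_prod_mul (fun x : ℝ => cexp (-(x - (a + b) / 2) ^ 2)) (fun y : ℝ =>
      (erfc (√2 * y) : ℂ) * (((b - a) / 2 + β * y) ^ 2 * cexp (-((b - a) / 2 + β * y) ^ 2))),
    integral_prod_mul (fun x : ℝ => (x - (a + b) / 2) ^ 2 * cexp (-(x - (a + b) / 2) ^ 2))
      (fun y : ℝ => (erfc (√2 * y) : ℂ) * cexp (-((b - a) / 2 + β * y) ^ 2)),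
    integral_cexp_neg_sub_sq, integral_sub_sq_mul_cexp_neg_sub_sq]
  have e' (y : ℝ) : (erfc (√2 * y) : ℂ) *
      ((((b - a) / 2 + β * y) ^ 2 - 1 / 2) * cexp (-((b - a) / 2 + β * y) ^ 2)) =
      (erfc (√2 * y) : ℂ) * (((b - a) / 2 + β * y) ^ 2 * cexp (-((b - a) / 2 + β * y) ^ 2)) -
      1 / 2 * ((erfc (√2 * y) : ℂ) * cexp (-((b - a) / 2 + β * y) ^ 2)) := by ring
  simp only [e']
  rw [integral_sub i2 (i0.const_mul _), integral_const_mul]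
  ring

open Complex in
/-- The scalar integrand of the complex part of the integration formula. -/
noncomputable def halfPlaneIntegrand (a b : ℂ) (p : ℝ × ℝ) : ℂ :=
  (erfc (√2 * p.2) : ℂ) * (I * (oddGaussian (p.1 + -I * p.2 - a) * oddGaussian (b - p.1 + -I * p.2) -
    oddGaussian (p.1 + I * p.2 - a) * oddGaussian (b - p.1 + I * p.2)))

open Complex in
lemma halfPlaneIntegrand_eq (a b : ℂ) : halfPlaneIntegrand a b = fun p : ℝ × ℝ =>
    I * ((erfc (√2 * p.2) : ℂ) *
      (oddGaussian (p.1 + -I * p.2 - a) * oddGaussian (b - p.1 + -I * p.2))) -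
    I * ((erfc (√2 * p.2) : ℂ) *
      (oddGaussian (p.1 + I * p.2 - a) * oddGaussian (b - p.1 + I * p.2))) := by
  ext p
  rw [halfPlaneIntegrand]
  ring

open Complex in
lemma integrableOn_halfPlaneIntegrand (a b : ℂ) :
    IntegrableOn (halfPlaneIntegrand a b) {q | 0 < q.2} := by
  have h1 := (integrable_and_integral_erfc_mul_oddGaussian a b (β := -I) (by simp)).1
  have h2 := (integrable_and_integral_erfc_mul_oddGaussian a b I_sq).1
  rw [halfPlaneIntegrand_eq]
  exact (h1.const_mul I).sub (h2.const_mul I)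

open Complex in
lemma integral_halfPlaneIntegrand (a b : ℂ) :
    ∫ p in {q : ℝ × ℝ | 0 < q.2}, halfPlaneIntegrand a b p =
      -((√π : ℝ) * ((b - a) / 2) * cexp (-((b - a) / 2) ^ 2)) +
      2 * (√2 : ℝ) * (√π : ℝ) * ((b - a) / 2) * cexp (-(2 * ((b - a) / 2) ^ 2)) := by
  have h1 := integrable_and_integral_erfc_mul_oddGaussian a b (β := -I) (by simp)
  have h2 := integrable_and_integral_erfc_mul_oddGaussian a b I_sq
  have p1 := integral_erfc_mul_gaussian_by_parts ((b - a) / 2) (β := -I) (by simp)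
  have p2 := integral_erfc_mul_gaussian_by_parts ((b - a) / 2) I_sq
  have hs := integral_Ioi_gaussian_symmetrized ((b - a) / 2)
  have hπ : ((√π : ℝ) : ℂ) ≠ 0 := by
    rw [ofReal_ne_zero]
    positivity
  have hc : ((2 * √2 / √π : ℝ) : ℂ) * (√π : ℝ) = 2 * (√2 : ℝ) := by
    push_cast
    field_simp
  rw [halfPlaneIntegrand_eq, integral_sub (h1.1.const_mul I) (h2.1.const_mul I),
    integral_const_mul, integral_const_mul, h1.2, h2.2]
  linear_combination ((√π : ℝ) / 2 : ℂ) * p1 + ((√π : ℝ) / 2 : ℂ) * p2 +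
    ((√π : ℝ) / 2 * (2 * √2 / √π : ℝ) : ℂ) * hs +
    ((√π : ℝ) * ((b - a) / 2) * cexp (-(2 * ((b - a) / 2) ^ 2))) * hc

open Complex in
/-- The scalar integrand of the real part of the integration formula. -/
noncomputable def lineIntegrand (a b : ℂ) (y : ℝ) : ℂ :=
  (b - a) * (cexp (-((y : ℂ) - a) ^ 2 / 2) * cexp (-((y : ℂ) - b) ^ 2 / 2))

open Complex in
lemma lineIntegrand_eq (a b : ℂ) : lineIntegrand a b = fun y : ℝ =>
    ((b - a) * cexp (-((b - a) / 2) ^ 2)) * cexp (-((y : ℂ) - (a + b) / 2) ^ 2) := by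
  ext y
  rw [lineIntegrand, ← Complex.exp_add, mul_assoc, ← Complex.exp_add]
  congr 2
  ring

lemma integrable_lineIntegrand (a b : ℂ) : Integrable (lineIntegrand a b) := by
  have h := integrable_sub_pow_mul_cexp_neg_sub_sq ((a + b) / 2) 0
  simp only [pow_zero, one_mul] at h
  rw [lineIntegrand_eq]
  exact h.const_mul _

open Complex in
lemma integral_lineIntegrand (a b : ℂ) : ∫ y, lineIntegrand a b y =
    (b - a) * cexp (-((b - a) / 2) ^ 2) * (√π : ℝ) := by
  rw [lineIntegrand_eq, integral_const_mul, integral_cexp_neg_sub_sq]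

open Complex in
lemma scalar_integration_formula (a b : ℂ) :
    ((1 / √(2 * π) : ℝ) : ℂ) ^ 2 * (∫ y, lineIntegrand a b y) +
      2 * (((1 / √(2 * π) : ℝ) : ℂ) ^ 2 *
        ∫ p in {q : ℝ × ℝ | 0 < q.2}, halfPlaneIntegrand a b p) =
      2 * (((1 / √(2 * π) : ℝ) : ℂ) * oddGaussian (b - a)) := by
  have hπ : ((√π : ℝ) : ℂ) ≠ 0 := by
    rw [ofReal_ne_zero]
    positivity
  have h2 : ((√2 : ℝ) : ℂ) ≠ 0 := by
    rw [ofReal_ne_zero]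
    positivity
  rw [integral_lineIntegrand, integral_halfPlaneIntegrand, oddGaussian,
    show -(b - a) ^ 2 / 2 = -(2 * ((b - a) / 2) ^ 2) by ring, Real.sqrt_mul zero_le_two]
  push_cast
  field_simp
  ring_nf

/-- The first-index prefactors `1, i` of the complex kernels. -/
noncomputable def rowPhase : Fin 2 → ℂ := ![1, Complex.I]

/-- The first-index nodes `z, z̄` of the complex kernels. -/
noncomputable def rowNode (z : ℂ) : Fin 2 → ℂ := ![z, (starRingEnd ℂ) z]

/-- The second-index prefactors `i, -1` of the tilded complex kernels. -/
noncomputable def colPhase : Fin 2 → ℂ := ![Complex.I, -1]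

/-- The second-index nodes `v̄, v` of the tilded complex kernels. -/
noncomputable def colNode (v : ℂ) : Fin 2 → ℂ := ![(starRingEnd ℂ) v, v]

lemma Ktcc_apply (z v : ℂ) (i j : Fin 2) :
    Ktcc z v i j = ((1 / √(2 * π) : ℝ) : ℂ) * (√(erfc (√2 * z.im)) : ℝ) *
      (√(erfc (√2 * v.im)) : ℝ) * (rowPhase i * colPhase j) *
        oddGaussian (colNode v j - rowNode z i) := by
  rw [Ktcc, Kcc, Real.sqrt_mul (erfc_nonneg _)]
  have e (a b : ℂ) : oddGaussian (b - a) = (b - a) * Complex.exp (-(a - b) ^ 2 / 2) := by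
    rw [oddGaussian]; congr 3; ring
  fin_cases i <;> fin_cases j <;>
    simp [J2, rowPhase, rowNode, colPhase, colNode, Matrix.mul_apply, e] <;> ring_nf <;> simp

lemma Ktcr_mul_Ktrc_apply (z v : ℂ) (y : ℝ) (i j : Fin 2) :
    (Ktcr z y * Ktrc y v) i j = ((√(erfc (√2 * z.im)) : ℝ) * (√(erfc (√2 * v.im)) : ℝ) *
      (rowPhase i * colPhase j)) * (((1 / √(2 * π) : ℝ) : ℂ) ^ 2 *
        lineIntegrand (rowNode z i) (colNode v j) y) := by
  rw [Ktcr, Ktrc, Kcr, Krc, Krc]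
  fin_cases i <;> fin_cases j <;>
    simp [J2, rowPhase, rowNode, colPhase, colNode, Matrix.mul_apply, lineIntegrand] <;>
    ring_nf <;> simp <;> ring_nf

lemma Ktcc_mul_Ktcc_apply (z v : ℂ) (p : ℝ × ℝ) (i j : Fin 2) :
    (Ktcc z ((p.1 : ℂ) + (p.2 : ℂ) * Complex.I) * Ktcc ((p.1 : ℂ) + (p.2 : ℂ) * Complex.I) v) i j =
      ((√(erfc (√2 * z.im)) : ℝ) * (√(erfc (√2 * v.im)) : ℝ) *
      (rowPhase i * colPhase j)) * (((1 / √(2 * π) : ℝ) : ℂ) ^ 2 *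
        halfPlaneIntegrand (rowNode z i) (colNode v j) p) := by
  have him : ((p.1 : ℂ) + (p.2 : ℂ) * Complex.I).im = p.2 := by simp
  have hconj : (starRingEnd ℂ) ((p.1 : ℂ) + (p.2 : ℂ) * Complex.I) =
      (p.1 : ℂ) + -Complex.I * p.2 := by simp; ring
  have hs : ((√(erfc (√2 * p.2)) : ℝ) : ℂ) ^ 2 = erfc (√2 * p.2) := by
    rw [← Complex.ofReal_pow, Real.sq_sqrt (erfc_nonneg _)]
  rw [Matrix.mul_apply, Fin.sum_univ_two, Ktcc_apply, Ktcc_apply, Ktcc_apply, Ktcc_apply, him,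
    halfPlaneIntegrand, ← hs]
  have c0 : colNode ((p.1 : ℂ) + (p.2 : ℂ) * Complex.I) 0 = (p.1 : ℂ) + -Complex.I * p.2 := hconj
  have c1 : colNode ((p.1 : ℂ) + (p.2 : ℂ) * Complex.I) 1 = (p.1 : ℂ) + Complex.I * p.2 := by
    simp [colNode, mul_comm]
  have r0 : rowNode ((p.1 : ℂ) + (p.2 : ℂ) * Complex.I) 0 = (p.1 : ℂ) + Complex.I * p.2 := by
    simp [rowNode, mul_comm]
  have r1 : rowNode ((p.1 : ℂ) + (p.2 : ℂ) * Complex.I) 1 = (p.1 : ℂ) + -Complex.I * p.2 := hconj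
  have ph : rowPhase 0 = 1 ∧ rowPhase 1 = Complex.I ∧ colPhase 0 = Complex.I ∧ colPhase 1 = -1 := by
    simp [rowPhase, colPhase]
  obtain ⟨h1, h2, h3, h4⟩ := ph
  rw [c0, c1, r0, r1, h1, h2, h3, h4]
  ring_nf

lemma matrix_integral_apply {α : Type*} [MeasurableSpace α] {μ : Measure α} {m n : Type*}
    [Fintype m] [Fintype n] {F : α → Matrix m n ℂ} (hF : ∀ i j, Integrable (fun x => F x i j) μ)
    (i : m) (j : n) : (∫ x, F x ∂μ) i j = ∫ x, F x i j ∂μ := by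
  have h1 : (∫ x, F x ∂μ) i = ∫ x, F x i ∂μ :=
    eval_integral (fun i => Integrable.of_eval (hF i)) i
  rw [h1]
  exact eval_integral (hF i) j

/-- Integration formula (complex-complex) for products of bulk-scaled real Ginibre matrix
kernels: for `Im z ≥ 0` and `Im v ≥ 0`,
`∫ K̃_{c,r}(z,y)K̃_{r,c}(y,v) dy + 2∫_{ℝ₊²} K̃_{c,c}(z,w)K̃_{c,c}(w,v) d²w = 2 K̃_{c,c}(z,v)`. -/
theorem stmt_17 (z v : ℂ) (hz : 0 ≤ z.im) (hv : 0 ≤ v.im) :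
    (∫ y : ℝ, Ktcr z y * Ktrc y v) +
      (2 : ℂ) • (∫ p in {q : ℝ × ℝ | 0 < q.2},
        Ktcc z ((p.1 : ℂ) + (p.2 : ℂ) * Complex.I) *
          Ktcc ((p.1 : ℂ) + (p.2 : ℂ) * Complex.I) v) =
      (2 : ℂ) • Ktcc z v := by
  ext i j
  have h₁ (i j : Fin 2) : Integrable fun y : ℝ => (Ktcr z y * Ktrc y v) i j := by
    simp only [Ktcr_mul_Ktrc_apply]
    exact ((integrable_lineIntegrand _ _).const_mul _).const_mul _
  have h₂ (i j : Fin 2) : IntegrableOn (fun p : ℝ × ℝ =>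
      (Ktcc z ((p.1 : ℂ) + (p.2 : ℂ) * Complex.I) *
        Ktcc ((p.1 : ℂ) + (p.2 : ℂ) * Complex.I) v) i j) {q : ℝ × ℝ | 0 < q.2} := by
    simp only [Ktcc_mul_Ktcc_apply]
    exact ((integrableOn_halfPlaneIntegrand _ _).const_mul _).const_mul _
  rw [Matrix.add_apply, Matrix.smul_apply, Matrix.smul_apply, matrix_integral_apply h₁,
    matrix_integral_apply h₂, Ktcc_apply]
  simp only [Ktcr_mul_Ktrc_apply, Ktcc_mul_Ktcc_apply, integral_const_mul, smul_eq_mul]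
  linear_combination ((√(erfc (√2 * z.im)) : ℝ) * (√(erfc (√2 * v.im)) : ℝ) *
    (rowPhase i * colPhase j)) * scalar_integration_formula (rowNode z i) (colNode v j)
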